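/- Let ℓ : Δ_{k,n} → [k] be a labeling such that every vertex x with ℓ(x) ∉ Support(x) satisfies x_k = 0 (all inadmissible labels lie on the face x_k = 0), and suppose the number of vertices with inadmissible labels is β·(n+k-2)!/n!. Then the number of non-monochromatic hyperedges of H_{k,n} is at least (1/(k-2)! − β)·(n+k-3)!/(n-1)!. -/

import Mathlib

open scoped BigOperators

/-- The discretized simplex `Δ_{k,n}`: points with nonnegative coordinates that are
integer multiples of `1/n` summing to `1`. -/
def disimplex (k n : ℕ) : Set (Fin k → ℚ) :=
  {x | (∀ i, 0 ≤ x i) ∧ (∀ i, ∃ m : ℤ, (n : ℚ) * x i = (m : ℚ)) ∧ ∑ i, x i = 1}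

/-- The `i`-th standard unit vector in `ℚ^k`. -/
def stdVec (k : ℕ) (i : Fin k) : Fin k → ℚ := fun j => if j = i then 1 else 0

/-- The hyperedge of `H_{k,n}` indexed by a point `z` of `Δ_{k,n-1}`. -/
def hyperedge (k n : ℕ) (z : Fin k → ℚ) : Set (Fin k → ℚ) :=
  {y | ∃ i : Fin k, y = fun j => (((n : ℚ) - 1) / n) * z j + (1 / n) * stdVec k i j}

/-- The set of hyperedges of the hypergraph `H_{k,n}`. -/
def hyperedges (k n : ℕ) : Set (Set (Fin k → ℚ)) :=
  (hyperedge k n) '' (disimplex k (n - 1))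

lemma sub_single_add_single {ι : Type*} [DecidableEq ι] {z : ι → ℕ} {i : ι} (h : 0 < z i) :
    z - Pi.single i 1 + Pi.single i 1 = z := by
  refine tsub_add_cancel_of_le fun j ↦ ?_
  rcases eq_or_ne j i with rfl | hj
  · simpa using Nat.succ_le_of_lt h
  · simp [hj]

open Finset in
lemma card_piAntidiag_univ {ι : Type*} [Fintype ι] [DecidableEq ι] (m : ℕ) :
    (piAntidiag (univ : Finset ι) m).card = (Fintype.card ι + m - 1).choose m := by
  classical
  rw [← map_sym_eq_piAntidiag, card_map, sym_univ, card_univ, Sym.card_sym_eq_choose]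

open Finset in
/-- The monochromatic hyperedges of size `p + 2` whose label is in the support of their index `z`
are at most as many as the points of the simplex of size `p`. -/
lemma card_le_card_piAntidiag_of_label_eq {ι : Type*} [Fintype ι] [DecidableEq ι] (p : ℕ)
    (L : (ι → ℕ) → ι) (c : (ι → ℕ) → ι) :
    (#{z ∈ piAntidiag univ (p + 1) | (∀ i, L (z + Pi.single i 1) = c z) ∧ 0 < z (c z)})
      ≤ (piAntidiag (univ : Finset ι) p).card := by
  refine card_le_card_of_injOn (fun z ↦ z - Pi.single (c z) 1) ?_ ?_
  · intro z hz
    simp only [coe_filter, mem_piAntidiag, mem_univ, implies_true, and_true,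
      Set.mem_ofPred_eq] at hz
    obtain ⟨hsum, -, hpos⟩ := hz
    have h : z - Pi.single (c z) 1 + Pi.single (c z) 1 = z :=
      sub_single_add_single hpos
    have h' := congrArg (fun f : ι → ℕ ↦ ∑ i, f i) h
    simp only [Pi.add_apply, sum_add_distrib, sum_pi_single', mem_univ, if_true, hsum] at h'
    simpa using h'
  · intro z hz z' hz' heq
    simp only [coe_filter, Set.mem_ofPred_eq] at hz hz'
    have h : z - Pi.single (c z) 1 + Pi.single (c z) 1 = z :=
      sub_single_add_single hz.2.2
    have h' : z' - Pi.single (c z') 1 + Pi.single (c z') 1 = z' :=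
      sub_single_add_single hz'.2.2
    dsimp only at heq
    have hc : c z = c z' := by
      refine (hz.2.1 (c z')).symm.trans (.trans (congrArg L ?_) (hz'.2.1 (c z)))
      calc z + Pi.single (c z') 1
          = z' - Pi.single (c z') 1 + Pi.single (c z) 1 + Pi.single (c z') 1 := by rw [← heq, h]
        _ = z' + Pi.single (c z) 1 := by rw [add_right_comm, h']
    rw [← h, ← h', heq, hc]

open Finset in
/-- Double counting of pairs `(z, z + e_j)` with `j ≠ t`, each weighted by `z j + 1`. -/
lemma card_mul_le_card_mul {ι : Type*} [Fintype ι] [DecidableEq ι] (m : ℕ) (t : ι)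
    (B I : Finset (ι → ℕ)) (hB : ∀ z ∈ B, ∑ i, z i = m) (ht : ∀ z ∈ B, z t = 0)
    (hBI : ∀ z ∈ B, ∀ j, j ≠ t → z + Pi.single j 1 ∈ I) (hI : ∀ x ∈ I, ∑ i, x i = m + 1) :
    #B * (m + Fintype.card ι - 1) ≤ #I * (m + 1) := by
  calc #B * (m + Fintype.card ι - 1) = ∑ z ∈ B, ∑ j ∈ univ.erase t, (z j + 1) := by
        rw [← smul_eq_mul, ← sum_const]
        refine sum_congr rfl fun z hz ↦ ?_
        rw [sum_add_distrib, sum_erase _ (ht z hz), hB z hz]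
        simp [card_erase_of_mem]
        have : 0 < Fintype.card ι := Fintype.card_pos_iff.2 ⟨t⟩
        omega
    _ = ∑ j ∈ univ.erase t, ∑ z ∈ B, (z j + 1) := sum_comm
    _ ≤ ∑ j ∈ univ.erase t, ∑ x ∈ I, x j := by
        refine sum_le_sum fun j hj ↦ ?_
        have hinj : Set.InjOn (fun z : ι → ℕ ↦ z + Pi.single j 1) B :=
          (add_left_injective _).injOn
        calc ∑ z ∈ B, (z j + 1) = ∑ x ∈ B.image (fun z ↦ z + Pi.single j 1), x j := by
              rw [sum_image hinj]; simp
          _ ≤ ∑ x ∈ I, x j := by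
              refine sum_le_sum_of_subset (image_subset_iff.2 fun z hz ↦ ?_)
              exact hBI z hz j (ne_of_mem_erase hj)
    _ ≤ ∑ j, ∑ x ∈ I, x j := sum_le_sum_of_subset (erase_subset _ _)
    _ = #I * (m + 1) := by
        rw [sum_comm, sum_congr rfl hI, sum_const, smul_eq_mul]

open Finset in
/-- The lower bound on the number of non-monochromatic hyperedges, on the integer simplex; `b` counts
the monochromatic hyperedges whose label is not in the support of their index. -/
lemma card_piAntidiag_le_add {k : ℕ} (p : ℕ) (t : Fin k) (L : (Fin k → ℕ) → Fin k)
    (hface : ∀ x ∈ piAntidiag univ (p + 2), x (L x) = 0 → x t = 0) :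
    ∃ b : ℕ, (piAntidiag (univ : Finset (Fin k)) (p + 1)).card ≤
        #{z ∈ piAntidiag univ (p + 1) | ¬ ∃ c, ∀ i, L (z + Pi.single i 1) = c}
          + (piAntidiag (univ : Finset (Fin k)) p).card + b ∧
      b * (p + k) ≤ #{x ∈ piAntidiag univ (p + 2) | x (L x) = 0} * (p + 2) := by
  set c : (Fin k → ℕ) → Fin k := fun z ↦ L (z + Pi.single t 1)
  set B : Finset (Fin k → ℕ) :=
    {z ∈ piAntidiag univ (p + 1) | (∀ i, L (z + Pi.single i 1) = c z) ∧ z (c z) = 0} with hB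
  refine ⟨#B, ?_, ?_⟩
  · set G : Finset (Fin k → ℕ) :=
      {z ∈ piAntidiag univ (p + 1) | (∀ i, L (z + Pi.single i 1) = c z) ∧ 0 < z (c z)}
    have h₁ : #G ≤ #(piAntidiag (univ : Finset (Fin k)) p) := by
      convert card_le_card_piAntidiag_of_label_eq p L c
    set N : Finset (Fin k → ℕ) :=
      {z ∈ piAntidiag univ (p + 1) | ¬ ∃ c, ∀ i, L (z + Pi.single i 1) = c}
    have hcover : piAntidiag univ (p + 1) ⊆ N ∪ G ∪ B := by
      intro z hz
      simp only [N, G, B, mem_union, mem_filter, hz, true_and]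
      by_cases h : ∃ c, ∀ i, L (z + Pi.single i 1) = c
      · obtain ⟨d, hd⟩ := h
        have : ∀ i, L (z + Pi.single i 1) = c z := fun i ↦ (hd i).trans (hd t).symm
        rcases Nat.eq_zero_or_pos (z (c z)) with h0 | h0
        · exact Or.inr ⟨this, h0⟩
        · exact Or.inl (Or.inr ⟨this, h0⟩)
      · exact Or.inl (Or.inl h)
    have h₂ := (card_le_card hcover).trans (card_union_le _ _)
    have h₃ := card_union_le N G
    omega
  · have hmem : ∀ z ∈ B, ∀ j, z + Pi.single j 1 ∈ piAntidiag (univ : Finset (Fin k)) (p + 2) := by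
      intro z hz j
      simp only [hB, mem_filter, mem_piAntidiag, mem_univ, implies_true, and_true] at hz ⊢
      simp [sum_add_distrib, hz.1]
    have hcol : ∀ z ∈ B, c z = t := by
      intro z hz
      by_contra hne
      have hz' := (mem_filter.1 hz).2
      have := hface _ (hmem z hz t) (by simp [hz'.1 t, hz'.2, hne])
      simp at this
    have := card_mul_le_card_mul (p + 1) t B {x ∈ piAntidiag univ (p + 2) | x (L x) = 0}
      (fun z hz ↦ by simpa using (mem_piAntidiag.1 (mem_filter.1 hz).1).1)
      (fun z hz ↦ by simpa [hcol z hz] using (mem_filter.1 hz).2.2)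
      (fun z hz j hj ↦ mem_filter.2 ⟨hmem z hz j, by
        have hz' := (mem_filter.1 hz).2
        rw [hcol z hz] at hz'
        simp [hz'.1 j, hz'.2, hj.symm]⟩)
      (fun x hx ↦ by simpa using (mem_piAntidiag.1 (mem_filter.1 hx).1).1)
    rwa [Fintype.card_fin, show p + 1 + k - 1 = p + k by omega] at this

open Finset in
lemma disimplex_eq_image (k : ℕ) {m : ℕ} (hm : m ≠ 0) :
    disimplex k m =
      (fun (w : Fin k → ℕ) i ↦ (w i : ℚ) / m) '' (piAntidiag univ m : Finset (Fin k → ℕ)) := by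
  have hm' : (m : ℚ) ≠ 0 := Nat.cast_ne_zero.2 hm
  ext x
  simp only [disimplex, Set.mem_ofPred_eq, Set.mem_image, mem_coe, mem_piAntidiag, mem_univ,
    implies_true, and_true]
  constructor
  · rintro ⟨h0, hint, hsum⟩
    choose a ha using hint
    have hnn : ∀ i, 0 ≤ a i := fun i ↦ by
      have : (0 : ℚ) ≤ a i := ha i ▸ mul_nonneg (Nat.cast_nonneg _) (h0 i)
      exact_mod_cast this
    have hcast : ∀ i, (((a i).toNat : ℕ) : ℚ) = m * x i := fun i ↦ by
      rw [ha, ← Int.cast_natCast, Int.toNat_of_nonneg (hnn i)]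
    refine ⟨fun i ↦ (a i).toNat, ?_, funext fun i ↦ ?_⟩
    · have : ((∑ i, (a i).toNat : ℕ) : ℚ) = m := by
        rw [Nat.cast_sum, sum_congr rfl fun i _ ↦ hcast i, ← mul_sum, hsum, mul_one]
      exact_mod_cast this
    · rw [hcast, mul_div_cancel_left₀ _ hm']
  · rintro ⟨w, hw, rfl⟩
    refine ⟨fun i ↦ by positivity, fun i ↦ ⟨w i, ?_⟩, ?_⟩
    · rw [mul_div_cancel₀ _ hm', Int.cast_natCast]
    · rw [← sum_div, ← Nat.cast_sum, hw, div_self hm']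

lemma hyperedge_injective {k n : ℕ} (hk : 2 ≤ k) (hn : 2 ≤ n) :
    Function.Injective (hyperedge k n) := by
  have hn' : (2 : ℚ) ≤ n := by exact_mod_cast hn
  have key : ∀ z z', hyperedge k n z = hyperedge k n z' → ∀ j, z' j ≤ z j := by
    intro z z' h j
    have : Nontrivial (Fin k) := Fin.nontrivial_iff_two_le.2 hk
    obtain ⟨i, hi⟩ := exists_ne j
    obtain ⟨i', hi'⟩ : (fun j ↦ (((n : ℚ) - 1) / n) * z j + (1 / n) * stdVec k i j) ∈
        hyperedge k n z' := h ▸ ⟨i, rfl⟩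
    have hj := congrFun hi' j
    have h0 : 0 ≤ stdVec k i' j := by unfold stdVec; split <;> norm_num
    have h1 : stdVec k i j = 0 := if_neg hi.symm
    rw [h1, mul_zero, add_zero] at hj
    have hpos : 0 < ((n : ℚ) - 1) / n := div_pos (by linarith) (by linarith)
    have h2 : 0 ≤ (1 / (n : ℚ)) * stdVec k i' j := mul_nonneg (by positivity) h0
    exact le_of_mul_le_mul_left (by linarith) hpos
  intro z z' h
  exact funext fun j ↦ le_antisymm (key _ _ h.symm j) (key _ _ h j)

lemma hyperedge_div (k : ℕ) {n : ℕ} (hn : 2 ≤ n) (w : Fin k → ℕ) :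
    hyperedge k n (fun i ↦ (w i : ℚ) / (n - 1 : ℕ)) =
      Set.range fun i ↦ (fun j ↦ ((w + Pi.single i 1 : Fin k → ℕ) j : ℚ) / n) := by
  have hn' : (2 : ℚ) ≤ n := by exact_mod_cast hn
  have h1 : (n : ℚ) - 1 ≠ 0 := by linarith
  have h2 : (n : ℚ) ≠ 0 := by linarith
  have key : ∀ i : Fin k,
      (fun j ↦ (((n : ℚ) - 1) / n) * ((w j : ℚ) / (n - 1 : ℕ)) + (1 / n) * stdVec k i j) =
        fun j ↦ ((w + Pi.single i 1 : Fin k → ℕ) j : ℚ) / n := by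
    intro i
    funext j
    rw [Nat.cast_sub (by omega)]
    simp only [stdVec, Pi.add_apply, Pi.single_apply, Nat.cast_add, Nat.cast_ite, Nat.cast_one,
      Nat.cast_zero]
    field_simp
  ext y
  simp only [hyperedge, key, Set.mem_ofPred_eq, Set.mem_range, eq_comm]

open Finset in
/-- If all inadmissible labels of `ℓ` lie on the face `x_k = 0` and there are
`β·(n+k-2)!/n!` inadmissibly labeled vertices, then the number of
non-monochromatic hyperedges of `H_{k,n}` is at least
`(1/(k-2)! − β)·(n+k-3)!/(n-1)!`. -/
theorem stmt5 (k n : ℕ) (hk : 2 ≤ k) (hn : 2 ≤ n)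
    (ℓ : (Fin k → ℚ) → Fin k) (β : ℚ)
    (hface : ∀ x ∈ disimplex k n, ¬ 0 < x (ℓ x) → x ⟨k - 1, by omega⟩ = 0)
    (hcount : ({x ∈ disimplex k n | ¬ 0 < x (ℓ x)}.ncard : ℚ)
        = β * (((n + k - 2).factorial : ℚ) / (n.factorial : ℚ))) :
    (1 / ((k - 2).factorial : ℚ) - β) * (((n + k - 3).factorial : ℚ) / ((n - 1).factorial : ℚ))
      ≤ ({e ∈ hyperedges k n | ¬ ∃ c, ∀ x ∈ e, ℓ x = c}.ncard : ℚ) := by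
  obtain ⟨p, rfl⟩ : ∃ p, n = p + 2 := ⟨n - 2, by omega⟩
  have hinj : ∀ m : ℕ, m ≠ 0 →
      Function.Injective (fun (w : Fin k → ℕ) i ↦ (w i : ℚ) / m) := by
    intro m hm w w' h
    funext i
    have := congrFun h i
    rw [div_left_inj' (Nat.cast_ne_zero.2 hm)] at this
    exact_mod_cast this
  set φ : (Fin k → ℕ) → Fin k → ℚ := fun w i ↦ (w i : ℚ) / (p + 2 : ℕ) with hφ
  have hzero : ∀ w i, φ w i = 0 ↔ w i = 0 := by
    intro w i
    simp only [hφ, div_eq_zero_iff, Nat.cast_eq_zero, Nat.add_eq_zero_iff, OfNat.ofNat_ne_zero,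
      and_false, or_false]
  have hpos : ∀ w i, ¬ 0 < φ w i ↔ w i = 0 := by
    intro w i
    rw [← hzero, not_lt]
    exact ⟨fun h ↦ le_antisymm h (by positivity), fun h ↦ h.le⟩
  have hdis : disimplex k (p + 2) = φ '' (piAntidiag univ (p + 2) : Finset (Fin k → ℕ)) :=
    disimplex_eq_image k (by omega)
  obtain ⟨b, hb₁, hb₂⟩ := card_piAntidiag_le_add p (⟨k - 1, by omega⟩ : Fin k) (fun w ↦ ℓ (φ w))
    (fun w hw h0 ↦ (hzero _ _).1 <|
      hface (φ w) (hdis ▸ Set.mem_image_of_mem φ hw) ((hpos _ _).2 h0))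
  have hbad : {x ∈ disimplex k (p + 2) | ¬ 0 < x (ℓ x)}.ncard =
      #{w ∈ piAntidiag (univ : Finset (Fin k)) (p + 2) | w (ℓ (φ w)) = 0} := by
    rw [← Set.ncard_coe_finset, ← Set.ncard_image_of_injective _ (hinj (p + 2) (by omega)), hdis]
    congr 1
    ext x
    simp only [Set.mem_ofPred_eq, Set.mem_image, mem_coe, mem_filter]
    constructor
    · rintro ⟨⟨w, hw, rfl⟩, h⟩
      exact ⟨w, ⟨hw, (hpos _ _).1 h⟩, rfl⟩
    · rintro ⟨w, ⟨hw, h⟩, rfl⟩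
      exact ⟨⟨w, hw, rfl⟩, (hpos _ _).2 h⟩
  have hnon : {e ∈ hyperedges k (p + 2) | ¬ ∃ c, ∀ x ∈ e, ℓ x = c}.ncard =
      #{z ∈ piAntidiag (univ : Finset (Fin k)) (p + 1) |
        ¬ ∃ c, ∀ i, ℓ (φ (z + Pi.single i 1)) = c} := by
    rw [← Set.ncard_coe_finset, ← Set.ncard_image_of_injective _
      ((hyperedge_injective hk hn).comp (hinj (p + 1) (by omega))), hyperedges,
      disimplex_eq_image k (by omega)]
    have hmono : ∀ z : Fin k → ℕ,
        (∃ c, ∀ x ∈ hyperedge k (p + 2) (fun i ↦ (z i : ℚ) / (p + 1 : ℕ)), ℓ x = c) ↔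
          ∃ c, ∀ i, ℓ (φ (z + Pi.single i 1)) = c := by
      intro z
      have := hyperedge_div k hn z
      simp only [show p + 2 - 1 = p + 1 from rfl] at this
      rw [this]
      simp only [Set.forall_mem_range, hφ]
    congr 1
    ext e
    simp only [Set.mem_ofPred_eq, Set.mem_image, mem_coe, mem_filter]
    constructor
    · rintro ⟨⟨_, ⟨w, hw, rfl⟩, rfl⟩, h⟩
      exact ⟨w, ⟨hw, fun h' ↦ h ((hmono w).2 h')⟩, rfl⟩
    · rintro ⟨w, ⟨hw, h⟩, rfl⟩
      exact ⟨⟨_, ⟨w, hw, rfl⟩, rfl⟩, fun h' ↦ h ((hmono w).1 h')⟩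
  rw [hnon]
  rw [hbad] at hcount
  obtain ⟨q, rfl⟩ : ∃ q, k = q + 2 := ⟨k - 2, by omega⟩
  simp only [card_piAntidiag_univ, Fintype.card_fin] at hb₁
  rw [show q + 2 + (p + 1) - 1 = p + q + 1 + 1 by omega, show q + 2 + p - 1 = p + q + 1 by omega,
    Nat.choose_succ_succ'] at hb₁
  have hchoose := Nat.add_choose_mul_factorial_mul_factorial q (p + 1)
  rw [show p + 2 + (q + 2) - 2 = p + q + 2 by omega] at hcount
  rw [show p + 2 + (q + 2) - 3 = p + q + 1 by omega, show q + 2 - 2 = q by omega,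
    show p + 2 - 1 = p + 1 by omega]
  set N := #{z ∈ piAntidiag (univ : Finset (Fin (q + 2))) (p + 1) |
    ¬ ∃ c, ∀ i, ℓ (φ (z + Pi.single i 1)) = c}
  set I := #{w ∈ piAntidiag (univ : Finset (Fin (q + 2))) (p + 2) | w (ℓ (φ w)) = 0}
  rw [show q + (p + 1) = p + q + 1 by omega] at hchoose
  have hN : ((p + q + 1).choose (p + 1) : ℚ) ≤ N + b := by exact_mod_cast (by omega)
  have hI : (b : ℚ) * (p + q + 2) ≤ I * (p + 2) := by
    have : b * (p + q + 2) ≤ I * (p + 2) := by simpa only [add_assoc] using hb₂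
    exact_mod_cast this
  have hquot : (1 / (q.factorial : ℚ)) * (((p + q + 1).factorial : ℚ) / ((p + 1).factorial : ℚ)) =
      (p + q + 1).choose (p + 1) := by
    rw [← hchoose]
    push_cast
    field_simp
  have hβ : (b : ℚ) ≤ β * (((p + q + 1).factorial : ℚ) / ((p + 1).factorial : ℚ)) := by
    have hscale : (I : ℚ) * (p + 2) =
        β * (((p + q + 1).factorial : ℚ) / ((p + 1).factorial : ℚ)) * (p + q + 2) := by
      rw [hcount, Nat.factorial_succ (p + q + 1), Nat.factorial_succ (p + 1)]
      push_cast
      field_simp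
      ring
    exact le_of_mul_le_mul_right (hI.trans_eq hscale) (by positivity)
  rw [sub_mul, hquot]
  linarith
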